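/- arXiv:2408.04196 — 3 statements merged into one kernel-verified Lean document; each statement's English description precedes it below -/
import Mathlib

section
/- Let p be a prime, j, k positive integers with k − j ≥ j, and let G = C_{p^k} ⋊ C_{p^j} = ⟨a, b | a^{p^k} = b^{p^j} = 1, b·a·b^{−1} = a^{p^{k−j}+1}⟩. Let V be a faithful irreducible complex representation of G. Then for all n ≥ 0: b_V(n) = ((p^j)^n / p^{k+j}) · ( (j+1)·p^k − j·p^{k−1} + (p^k − p^{k−1}) · Σ_{m=0}^{j−1} (m+1) · R_{j−m}(n) ), where R_i(n) := Σ_{ω} ω^n, the sum running over all primitive p^i-th roots of unity ω ∈ ℂ. -/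
open CategoryTheory Finset

/-- `bV χ V n = ∑ₜ ⟨χ_V^n, χₜ⟩`, the number of irreducible summands (with multiplicity)
of `V^{⊗n}`, where `⟨φ, ψ⟩ = (1/|G|) ∑_g φ(g) conj(ψ(g))`. -/
noncomputable def bV {G : Type} [Group G] [Fintype G] {N : ℕ}
    (χ : Fin N → FDRep ℂ G) (V : FDRep ℂ G) (n : ℕ) : ℂ :=
  ∑ t, (1 / (Fintype.card G : ℂ)) *
    ∑ g, V.character g ^ n * (starRingEnd ℂ) ((χ t).character g)

/-- The Ramanujan sum `R_i(n) = ∑_ω ω^n` over all primitive `p^i`-th roots of unity in `ℂ`. -/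
noncomputable def ramanujanSum (p i n : ℕ) : ℂ :=
  ∑ ω ∈ primitiveRoots (p ^ i) ℂ, ω ^ n

open scoped commutatorElement

/-- The sum of the `n`-th powers of all `N`-th roots of unity. -/
theorem sum_nthRootsFinset_pow {N : ℕ} (hN : N ≠ 0) (n : ℕ) :
    ∑ ω ∈ Polynomial.nthRootsFinset N (1 : ℂ), ω ^ n = if N ∣ n then (N : ℂ) else 0 := by
  have hN' := Nat.pos_of_ne_zero hN
  have hζ := Complex.isPrimitiveRoot_exp N hN
  set ζ := Complex.exp (2 * Real.pi * Complex.I / N)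
  split_ifs with h
  · obtain ⟨m, rfl⟩ := h
    rw [Finset.sum_congr rfl (g := fun _ ↦ (1 : ℂ)) fun ω hω ↦ by
      rw [pow_mul, (Polynomial.mem_nthRootsFinset hN' 1).1 hω, one_pow]]
    simp [hζ.card_nthRootsFinset]
  · have hne : ζ ^ n ≠ 1 := fun h1 ↦ h (hζ.dvd_of_pow_eq_one n h1)
    have hshift : ∑ ω ∈ Polynomial.nthRootsFinset N (1 : ℂ), ω ^ n =
        ζ ^ n * ∑ ω ∈ Polynomial.nthRootsFinset N (1 : ℂ), ω ^ n := by
      rw [Finset.mul_sum]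
      symm
      refine Finset.sum_equiv (Equiv.mulLeft₀ ζ (hζ.ne_zero hN)) (fun ω ↦ ?_) fun ω _ ↦ ?_
      · simp [Polynomial.mem_nthRootsFinset hN', mul_pow, hζ.pow_eq_one]
      · simp [mul_pow]
    by_contra h0
    exact hne ((mul_eq_right₀ h0).1 hshift.symm)

theorem sum_range_ramanujanSum {p : ℕ} (hp : p.Prime) (s n : ℕ) :
    ∑ i ∈ Finset.range (s + 1), ramanujanSum p i n = if p ^ s ∣ n then (p : ℂ) ^ s else 0 := by
  have hps : p ^ s ≠ 0 := pow_ne_zero _ hp.ne_zero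
  have := sum_nthRootsFinset_pow hps n
  rw [IsPrimitiveRoot.nthRoots_one_eq_biUnion_primitiveRoots,
    Finset.sum_biUnion fun _ _ _ _ hne ↦ IsPrimitiveRoot.disjoint hne,
    Nat.sum_divisors_prime_pow hp] at this
  rw [← Nat.cast_pow, ← this]
  rfl

theorem sum_mul_ramanujanSum {p : ℕ} (hp : p.Prime) (j n : ℕ) :
    ((p : ℂ) - 1) * ∑ m ∈ Finset.range j, ((m : ℂ) + 1) * ramanujanSum p (j - m) n =
      p * (Nat.gcd (p ^ j) n : ℕ) - (j + 1) * p + j := by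
  induction j with
  | zero => simp
  | succ j ih =>
    have h0 : ramanujanSum p 0 n = 1 := by simp [ramanujanSum]
    have hT := sum_range_ramanujanSum hp (j + 1) n
    rw [Finset.sum_range_succ', h0, ← Finset.sum_range_reflect, Finset.sum_range_succ'] at hT
    have hrec : ∑ m ∈ Finset.range (j + 1), ((m : ℂ) + 1) * ramanujanSum p (j + 1 - m) n =
        ∑ m ∈ Finset.range j, ((m : ℂ) + 1) * ramanujanSum p (j - m) n +
          ((if p ^ (j + 1) ∣ n then (p : ℂ) ^ (j + 1) else 0) - 1) := by
      rw [← hT, Finset.sum_range_succ', Finset.sum_congr rfl (g := fun m : ℕ ↦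
        ((m : ℂ) + 1) * ramanujanSum p (j - m : ℕ) n + ramanujanSum p (j - m : ℕ) n) fun m _ ↦ by
          rw [Nat.add_sub_add_right]; push_cast; ring, Finset.sum_add_distrib,
        Finset.sum_congr rfl (g := fun m : ℕ ↦ ramanujanSum p (j - m) n)
          (f := fun m ↦ ramanujanSum p (j + 1 - 1 - (m + 1) + 1) n) fun m hm ↦ by
          congr 1; have := Finset.mem_range.1 hm; omega]
      simp
      ring
    rw [hrec, mul_add, ih]
    split_ifs with h
    · rw [Nat.gcd_eq_left h, Nat.gcd_eq_left ((pow_dvd_pow p j.le_succ).trans h)]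
      push_cast
      ring
    · have hg : Nat.gcd (p ^ (j + 1)) n = Nat.gcd (p ^ j) n := by
        refine Nat.dvd_antisymm (Nat.dvd_gcd ?_ (Nat.gcd_dvd_right _ _))
          (Nat.gcd_dvd_gcd_of_dvd_left _ (pow_dvd_pow p j.le_succ))
        obtain ⟨i, hi, hi'⟩ := (Nat.dvd_prime_pow hp).1 (Nat.gcd_dvd_left (p ^ (j + 1)) n)
        rw [hi']
        refine pow_dvd_pow p (Nat.lt_succ_iff.1 (lt_of_le_of_ne hi ?_))
        rintro rfl
        exact h (hi' ▸ Nat.gcd_dvd_right _ _)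
      rw [hg]
      push_cast
      ring

theorem SemiconjBy.pow_mul_pow_eq {G : Type*} [Group G] {a b c : G}
    (hca : Commute c a) (hcb : Commute c b) (h : SemiconjBy b a (c * a)) (x y : ℕ) :
    b ^ y * a ^ x = c ^ (x * y) * (a ^ x * b ^ y) := by
  have hx : b * a ^ x = c ^ x * a ^ x * b := by
    rw [← hca.mul_pow]
    exact h.pow_right x
  induction y with
  | zero => simp
  | succ y ih =>
    rw [pow_succ', mul_assoc, ih, ← mul_assoc, ← ((hcb.pow_left (x * y)).eq), mul_assoc,
      ← mul_assoc b, hx, mul_add, pow_add]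
    simp [mul_assoc]

/-- The multiplication rule for two elements `a ^ x * b ^ y`. -/
theorem SemiconjBy.pow_mul_pow_mul_pow_mul_pow {G : Type*} [Group G] {a b c : G}
    (hca : Commute c a) (hcb : Commute c b) (h : SemiconjBy b a (c * a)) (x y x' y' : ℕ) :
    a ^ x * b ^ y * (a ^ x' * b ^ y') = c ^ (x' * y) * (a ^ (x + x') * b ^ (y + y')) := by
  rw [mul_assoc, ← mul_assoc (b ^ y), SemiconjBy.pow_mul_pow_eq hca hcb h, ← mul_assoc,
    ← mul_assoc, ← (hca.pow_pow (x' * y) x).eq, pow_add, pow_add]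
  simp [mul_assoc]

/-- The multiplicative structure of the modular group `C_{p^k} ⋊ C_{p^j}`. -/
theorem modular_group_relations {p j k : ℕ} (hjk : 2 * j ≤ k) {G : Type*} [Group G] {a b : G}
    (ha : a ^ p ^ k = 1) (hrel : b * a * b⁻¹ = a ^ (p ^ (k - j) + 1)) :
    Commute (a ^ p ^ (k - j)) b ∧ SemiconjBy b a (a ^ p ^ (k - j) * a) := by
  have h : SemiconjBy b a (a ^ p ^ (k - j) * a) := by
    rw [← pow_succ, ← hrel]
    simp [SemiconjBy]
  refine ⟨?_, h⟩
  have h2 := h.pow_right (p ^ (k - j))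
  rw [(Commute.pow_self a _).mul_pow, ← pow_mul, ← pow_add p] at h2
  have h3 : a ^ p ^ (k - j + (k - j)) = 1 := by
    obtain ⟨d, hd⟩ := pow_dvd_pow p (show k ≤ k - j + (k - j) by omega)
    rw [hd, pow_mul, ha, one_pow]
  rw [h3, one_mul] at h2
  exact h2.symm

theorem modular_group_exists_eq {p j k : ℕ} (hjk : 2 * j ≤ k) {G : Type*} [Group G] [Finite G]
    {a b : G} (ha : a ^ p ^ k = 1) (hrel : b * a * b⁻¹ = a ^ (p ^ (k - j) + 1))
    (hgen : Subgroup.closure {a, b} = ⊤) (g : G) : ∃ x y : ℕ, a ^ x * b ^ y = g := by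
  obtain ⟨hcb, hsc⟩ := modular_group_relations hjk ha hrel
  have hg : g ∈ Submonoid.closure {a, b} := by
    rw [← Subgroup.closure_toSubmonoid_of_finite, hgen]
    trivial
  induction hg using Submonoid.closure_induction with
  | mem g hg =>
    rcases hg with rfl | rfl
    · exact ⟨1, 0, by simp⟩
    · exact ⟨0, 1, by simp⟩
  | one => exact ⟨0, 0, by simp⟩
  | mul g h _ _ hg hh =>
    obtain ⟨x, y, rfl⟩ := hg
    obtain ⟨x', y', rfl⟩ := hh
    refine ⟨p ^ (k - j) * (x' * y) + (x + x'), y + y', ?_⟩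
    rw [SemiconjBy.pow_mul_pow_mul_pow_mul_pow (Commute.pow_self a _) hcb hsc, ← pow_mul,
      pow_add, mul_assoc]

theorem modular_group_unique {p j k : ℕ} (hp : p.Prime) (hjk : 2 * j ≤ k) {G : Type*} [Group G]
    [Fintype G] {a b : G} (ha : a ^ p ^ k = 1) (hb : b ^ p ^ j = 1)
    (hrel : b * a * b⁻¹ = a ^ (p ^ (k - j) + 1)) (hgen : Subgroup.closure {a, b} = ⊤)
    (hcard : Fintype.card G = p ^ (k + j)) {x y x' y' : ℕ} (hx : x < p ^ k) (hx' : x' < p ^ k)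
    (hy : y < p ^ j) (hy' : y' < p ^ j) (h : a ^ x * b ^ y = a ^ x' * b ^ y') :
    x = x' ∧ y = y' := by
  let f : Fin (p ^ k) × Fin (p ^ j) → G := fun z ↦ a ^ (z.1 : ℕ) * b ^ (z.2 : ℕ)
  have hf : Function.Surjective f := fun g ↦ by
    obtain ⟨u, v, rfl⟩ := modular_group_exists_eq hjk ha hrel hgen g
    refine ⟨(⟨u % p ^ k, Nat.mod_lt _ (pow_pos hp.pos _)⟩,
      ⟨v % p ^ j, Nat.mod_lt _ (pow_pos hp.pos _)⟩), ?_⟩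
    simp only [f]
    rw [← pow_eq_pow_mod _ ha, ← pow_eq_pow_mod _ hb]
  have hbij : Function.Bijective f := (Fintype.bijective_iff_surjective_and_card f).2
    ⟨hf, by simp [hcard, pow_add]⟩
  have := hbij.1 (a₁ := (⟨x, hx⟩, ⟨y, hy⟩)) (a₂ := (⟨x', hx'⟩, ⟨y', hy'⟩)) h
  simpa using this

theorem modular_group_pow_eq_one_iff {p j k : ℕ} (hp : p.Prime) (hjk : 2 * j ≤ k) {G : Type*}
    [Group G] [Fintype G] {a b : G} (ha : a ^ p ^ k = 1) (hb : b ^ p ^ j = 1)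
    (hrel : b * a * b⁻¹ = a ^ (p ^ (k - j) + 1)) (hgen : Subgroup.closure {a, b} = ⊤)
    (hcard : Fintype.card G = p ^ (k + j)) (m : ℕ) :
    (a ^ p ^ (k - j)) ^ m = 1 ↔ p ^ j ∣ m := by
  have hk : p ^ k = p ^ (k - j) * p ^ j := by rw [← pow_add, Nat.sub_add_cancel (by omega)]
  have hpos := pow_pos hp.pos (k - j)
  rw [← Nat.mul_dvd_mul_iff_left hpos, ← hk, ← pow_mul]
  constructor
  · intro h
    have hlt := Nat.mod_lt (p ^ (k - j) * m) (pow_pos hp.pos k)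
    rw [Nat.dvd_iff_mod_eq_zero]
    refine (modular_group_unique hp hjk ha hb hrel hgen hcard hlt (pow_pos hp.pos k)
      (pow_pos hp.pos j) (pow_pos hp.pos j) ?_).1
    rw [pow_zero, mul_one, mul_one, pow_zero, ← h, ← pow_eq_pow_mod _ ha]
  · rintro ⟨d, hd⟩
    rw [hd, pow_mul, ha, one_pow]

theorem modular_group_mem_center {p j k : ℕ} (hjk : 2 * j ≤ k) {G : Type*} [Group G]
    {a b : G} (ha : a ^ p ^ k = 1) (hrel : b * a * b⁻¹ = a ^ (p ^ (k - j) + 1))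
    (hgen : Subgroup.closure {a, b} = ⊤) : a ^ p ^ (k - j) ∈ Subgroup.center G := by
  have h : Subgroup.closure {a, b} ≤ Subgroup.centralizer {a ^ p ^ (k - j)} := by
    rw [Subgroup.closure_le]
    rintro g (rfl | rfl)
    · exact Subgroup.mem_centralizer_singleton_iff.2 (Commute.self_pow _ _).eq
    · exact Subgroup.mem_centralizer_singleton_iff.2 (modular_group_relations hjk ha hrel).1.symm.eq
  rw [hgen] at h
  exact Subgroup.mem_center_iff.2 fun g ↦
    Subgroup.mem_centralizer_singleton_iff.1 (h (Subgroup.mem_top g))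

theorem modular_group_commutator {p j k : ℕ} (hjk : 2 * j ≤ k) {G : Type*} [Group G]
    {a b : G} (ha : a ^ p ^ k = 1) (hrel : b * a * b⁻¹ = a ^ (p ^ (k - j) + 1)) (x y x' y' : ℕ) :
    ⁅a ^ x' * b ^ y', a ^ x * b ^ y⁆ =
      (a ^ p ^ (k - j)) ^ (x * y') * ((a ^ p ^ (k - j)) ^ (x' * y))⁻¹ := by
  obtain ⟨hcb, hsc⟩ := modular_group_relations hjk ha hrel
  have hca := Commute.pow_self a (p ^ (k - j))
  have hcomm : ∀ g h : G, ⁅h, g⁆ = h * g * (g * h)⁻¹ := fun g h ↦ by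
    simp [commutatorElement_def, mul_assoc]
  rw [hcomm, SemiconjBy.pow_mul_pow_mul_pow_mul_pow hca hcb hsc,
    SemiconjBy.pow_mul_pow_mul_pow_mul_pow hca hcb hsc, add_comm x', add_comm y', mul_inv_rev,
    mul_assoc, mul_inv_cancel_left]

theorem modular_group_commutator_mem_center {p j k : ℕ} (hjk : 2 * j ≤ k) {G : Type*} [Group G]
    [Finite G] {a b : G} (ha : a ^ p ^ k = 1) (hrel : b * a * b⁻¹ = a ^ (p ^ (k - j) + 1))
    (hgen : Subgroup.closure {a, b} = ⊤) (h g : G) : ⁅h, g⁆ ∈ Subgroup.center G := by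
  obtain ⟨x, y, rfl⟩ := modular_group_exists_eq hjk ha hrel hgen g
  obtain ⟨x', y', rfl⟩ := modular_group_exists_eq hjk ha hrel hgen h
  have hc := modular_group_mem_center hjk ha hrel hgen
  rw [modular_group_commutator hjk ha hrel]
  exact mul_mem (pow_mem hc _) (inv_mem (pow_mem hc _))

/-- The elements of the modular group all of whose commutators are killed by `n`. -/
theorem modular_group_card_commutator_pow_eq_one {p j k i n : ℕ} (hp : p.Prime)
    (hjk : 2 * j ≤ k) {G : Type*}
    [Group G] [Fintype G] {a b : G} (ha : a ^ p ^ k = 1) (hb : b ^ p ^ j = 1)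
    (hrel : b * a * b⁻¹ = a ^ (p ^ (k - j) + 1)) (hgen : Subgroup.closure {a, b} = ⊤)
    (hcard : Fintype.card G = p ^ (k + j)) (hi : i ≤ j) (hn : ∀ x, p ^ j ∣ x * n ↔ p ^ i ∣ x)
    (S : Finset G) (hS : ∀ g, g ∈ S ↔ ∀ h : G, ⁅h, g⁆ ^ n = 1) :
    #S = p ^ (k - i) * p ^ (j - i) := by
  have hmem : ∀ x y : ℕ, a ^ x * b ^ y ∈ S ↔ p ^ i ∣ x ∧ p ^ i ∣ y := fun x y ↦ by
    have hpow : ∀ x' y' : ℕ, ⁅a ^ x' * b ^ y', a ^ x * b ^ y⁆ ^ n = 1 ↔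
        (a ^ p ^ (k - j)) ^ (x * n * y') = (a ^ p ^ (k - j)) ^ (y * n * x') := fun x' y' ↦ by
      rw [modular_group_commutator hjk ha hrel, Commute.mul_pow (by
        exact (Commute.pow_pow_self _ _ _).inv_right), inv_pow, mul_inv_eq_one, ← pow_mul,
        ← pow_mul _ (x' * y), mul_right_comm, mul_comm x' y, mul_right_comm y]
    have hone := modular_group_pow_eq_one_iff hp hjk ha hb hrel hgen hcard
    rw [hS, ← hn, ← hn, ← hone, ← hone]
    constructor
    · intro h
      refine ⟨?_, ?_⟩
      · simpa using (hpow 0 1).1 (h _)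
      · simpa using ((hpow 1 0).1 (h _)).symm
    · rintro ⟨h1, h2⟩ g
      obtain ⟨x', y', rfl⟩ := modular_group_exists_eq hjk ha hrel hgen g
      rw [hpow, pow_mul _ (x * n), pow_mul _ (y * n), h1, h2, one_pow, one_pow]
  have hpi := pow_pos hp.pos i
  have hki : p ^ k = p ^ i * p ^ (k - i) := by rw [← pow_add, Nat.add_sub_cancel' (by omega)]
  have hji : p ^ j = p ^ i * p ^ (j - i) := by rw [← pow_add, Nat.add_sub_cancel' (by omega)]
  rw [← Finset.card_range (p ^ (k - i)), ← Finset.card_range (p ^ (j - i)), ← Finset.card_product]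
  symm
  refine Finset.card_bij (fun z _ ↦ a ^ (p ^ i * z.1) * b ^ (p ^ i * z.2)) ?_ ?_ ?_
  · intro z _
    exact (hmem _ _).2 ⟨dvd_mul_right _ _, dvd_mul_right _ _⟩
  · rintro ⟨u, v⟩ hz ⟨u', v'⟩ hz' h
    simp only [Finset.mem_product, Finset.mem_range] at hz hz'
    rw [Prod.mk.injEq, ← Nat.mul_right_inj hpi.ne',
      ← Nat.mul_right_inj (b := v) hpi.ne']
    refine modular_group_unique hp hjk ha hb hrel hgen hcard ?_ ?_ ?_ ?_ h
    · rw [hki]; exact Nat.mul_lt_mul_of_pos_left hz.1 hpi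
    · rw [hki]; exact Nat.mul_lt_mul_of_pos_left hz'.1 hpi
    · rw [hji]; exact Nat.mul_lt_mul_of_pos_left hz.2 hpi
    · rw [hji]; exact Nat.mul_lt_mul_of_pos_left hz'.2 hpi
  · intro g hg
    obtain ⟨x, y, rfl⟩ := modular_group_exists_eq hjk ha hrel hgen g
    obtain ⟨⟨u, rfl⟩, ⟨v, rfl⟩⟩ := (hmem x y).1 hg
    refine ⟨(u % p ^ (k - i), v % p ^ (j - i)), ?_, ?_⟩
    · exact Finset.mem_product.2 ⟨Finset.mem_range.2 (Nat.mod_lt _ (pow_pos hp.pos _)),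
        Finset.mem_range.2 (Nat.mod_lt _ (pow_pos hp.pos _))⟩
    · rw [← Nat.mul_mod_mul_left, ← Nat.mul_mod_mul_left, ← hki, ← hji,
        ← pow_eq_pow_mod _ ha, ← pow_eq_pow_mod _ hb]

/-- Schur's lemma: an endomorphism commuting with an irreducible complex representation is a
scalar. -/
theorem FDRep.exists_eq_smul_one_of_commute {G : Type} [Group G] (W : FDRep ℂ G) [Simple W]
    (f : W →ₗ[ℂ] W) (hf : ∀ g, W.ρ g * f = f * W.ρ g) : ∃ c : ℂ, f = c • 1 := by
  let F : W ⟶ W := FDRep.forget₂HomLinearEquiv W W (Rep.ofHom ⟨f, fun g ↦ (hf g).symm⟩)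
  obtain ⟨c, hc⟩ := endomorphism_simple_eq_smul_id ℂ F
  refine ⟨c, ?_⟩
  have h := congrArg (fun φ : W ⟶ W ↦ φ.hom.hom.hom) hc
  exact h.symm

theorem FDRep.finrank_ne_zero {G : Type} [Group G] [Fintype G] (W : FDRep ℂ G) [Simple W] :
    Module.finrank ℂ W ≠ 0 := by
  intro h
  have hsum := (FDRep.simple_iff_char_is_norm_one W).1 inferInstance
  have : Subsingleton W := Module.finrank_zero_iff.1 h
  have h0 : ∀ g, W.character g = 0 := fun g ↦ by
    rw [FDRep.character, Subsingleton.elim (W.ρ g) 0, map_zero]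
  simp only [h0, mul_zero, Finset.sum_const_zero] at hsum
  exact NeZero.ne (Nat.card G : ℂ) hsum.symm

theorem FDRep.exists_eq_smul_one_of_mem_center {G : Type} [Group G] (W : FDRep ℂ G) [Simple W]
    {z : G} (hz : z ∈ Subgroup.center G) : ∃ c : ℂ, W.ρ z = c • 1 :=
  W.exists_eq_smul_one_of_commute _ fun g ↦ by
    rw [← map_mul, ← map_mul, Subgroup.mem_center_iff.1 hz g]

theorem FDRep.character_mul_of_eq_smul_one {G : Type} [Group G] (W : FDRep ℂ G)
    {z : G} {c : ℂ} (h : W.ρ z = c • 1) (g : G) :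
    W.character (z * g) = c * W.character g := by
  simp [FDRep.character, h]

theorem FDRep.character_of_eq_smul_one {G : Type} [Group G] (W : FDRep ℂ G)
    {z : G} {c : ℂ} (h : W.ρ z = c • 1) :
    W.character z = c * Module.finrank ℂ W := by
  simpa using W.character_mul_of_eq_smul_one h 1

theorem FDRep.smul_one_injective {G : Type} [Group G] [Fintype G] (W : FDRep ℂ G) [Simple W]
    {c d : ℂ} (h : c • (1 : Module.End ℂ W) = d • 1) : c = d := by
  have h' := congrArg (LinearMap.trace ℂ W) h
  simpa [W.finrank_ne_zero] using h'

theorem FDRep.norm_eq_one_of_eq_smul_one {G : Type} [Group G] [Fintype G] (W : FDRep ℂ G)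
    [Simple W] {z : G} {c : ℂ} (h : W.ρ z = c • 1) : ‖c‖ = 1 := by
  refine Complex.norm_eq_one_of_pow_eq_one (n := Fintype.card G) ?_ Fintype.card_ne_zero
  apply W.smul_one_injective
  rw [one_smul, ← one_pow (M := Module.End ℂ W) (Fintype.card G), ← smul_pow, ← h, ← map_pow,
    pow_card_eq_one, map_one, one_pow]

/-- In a group whose commutators are central, an irreducible character vanishes at `g` unless `g`
is central modulo the kernel of the representation. -/
theorem FDRep.character_eq_zero_of_commutator {G : Type} [Group G] [Fintype G]
    (hG : ∀ h g : G, ⁅h, g⁆ ∈ Subgroup.center G) (W : FDRep ℂ G) [Simple W] {g : G}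
    (hg : ¬ ∀ h : G, W.ρ ⁅h, g⁆ = 1) : W.character g = 0 := by
  push Not at hg
  obtain ⟨h, hh⟩ := hg
  obtain ⟨c, hc⟩ := W.exists_eq_smul_one_of_mem_center (hG h g)
  have h1 : W.character g = c * W.character g := by
    rw [← W.character_mul_of_eq_smul_one hc, ← W.char_conj g h]
    congr 1
    simp [commutatorElement_def]
  by_contra h0
  refine hh ?_
  rw [hc, (mul_eq_right₀ h0).1 h1.symm, one_smul]

theorem FDRep.exists_eq_smul_one_of_commutator {G : Type} [Group G]
    (W : FDRep ℂ G) [Simple W] {g : G}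
    (hg : ∀ h : G, W.ρ ⁅h, g⁆ = 1) : ∃ c : ℂ, W.ρ g = c • 1 :=
  W.exists_eq_smul_one_of_commute _ fun h ↦ by
    rw [← map_mul, ← map_mul, ← one_mul (W.ρ (g * h)), ← hg h, ← map_mul]
    congr 1
    simp [commutatorElement_def, mul_assoc]

theorem FDRep.conj_character {G : Type} [Group G] [Fintype G]
    (hG : ∀ h g : G, ⁅h, g⁆ ∈ Subgroup.center G) (W : FDRep ℂ G) [Simple W] (g : G) :
    (starRingEnd ℂ) (W.character g) = W.character g⁻¹ := by
  by_cases hg : ∀ h : G, W.ρ ⁅h, g⁆ = 1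
  · obtain ⟨c, hc⟩ := W.exists_eq_smul_one_of_commutator hg
    have hn := W.norm_eq_one_of_eq_smul_one hc
    have h1 : W.character 1 = c * W.character g⁻¹ := by
      rw [← W.character_mul_of_eq_smul_one hc, mul_inv_cancel]
    rw [W.char_one] at h1
    have hc0 : c ≠ 0 := by rintro rfl; simp at hn
    apply mul_left_cancel₀ hc0
    rw [← h1, W.character_of_eq_smul_one hc, map_mul, ← mul_assoc, Complex.mul_conj,
      Complex.normSq_eq_norm_sq, hn]
    simp
  · have hg' : ¬ ∀ h : G, W.ρ ⁅h, g⁻¹⁆ = 1 := by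
      contrapose! hg
      intro h
      obtain ⟨c, hc⟩ := W.exists_eq_smul_one_of_commutator hg
      have hcomm : W.ρ (h⁻¹ * g⁻¹) = W.ρ (g⁻¹ * h⁻¹) := by rw [map_mul, map_mul, hc]; simp
      rw [commutatorElement_def, mul_assoc, map_mul, hcomm, ← map_mul]
      simp
    rw [W.character_eq_zero_of_commutator hG hg, W.character_eq_zero_of_commutator hG hg', map_zero]

theorem FDRep.finrank_sq_mul_card {G : Type} [Group G] [Fintype G]
    (hG : ∀ h g : G, ⁅h, g⁆ ∈ Subgroup.center G) (W : FDRep ℂ G) [Simple W]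
    (S : Finset G) (hS : ∀ g, g ∈ S ↔ ∀ h : G, W.ρ ⁅h, g⁆ = 1) :
    Module.finrank ℂ W ^ 2 * #S = Fintype.card G := by
  have hsum := (FDRep.simple_iff_char_is_norm_one W).1 inferInstance
  rw [← Finset.sum_subset (Finset.subset_univ S) fun g _ hg ↦ by
    rw [W.character_eq_zero_of_commutator hG (mt (hS g).2 hg), zero_mul]] at hsum
  rw [Finset.sum_congr rfl (g := fun _ ↦ (Module.finrank ℂ W : ℂ) ^ 2) fun g hg ↦ by
    obtain ⟨c, hc⟩ := W.exists_eq_smul_one_of_commutator ((hS g).1 hg)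
    rw [W.character_of_eq_smul_one hc, mul_right_comm, ← W.character_mul_of_eq_smul_one hc,
      mul_inv_cancel, W.char_one, sq], Finset.sum_const, nsmul_eq_mul, mul_comm,
    Nat.card_eq_fintype_card] at hsum
  exact_mod_cast hsum

theorem FDRep.simple_of_of_isIrreducible {G : Type} [Group G] [Fintype G] {W : Type}
    [AddCommGroup W] [Module ℂ W] [FiniteDimensional ℂ W] (ρ : Representation ℂ G W)
    [ρ.IsIrreducible] : Simple (FDRep.of ρ) := by
  have := invertibleOfNonzero (NeZero.ne (Nat.card G : ℂ))
  rw [FDRep.simple_iff_char_is_norm_one]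
  have h := Representation.char_orthonormal ρ ρ
  rw [if_pos ⟨Representation.Equiv.refl ρ⟩, inv_mul_eq_one₀ (NeZero.ne _)] at h
  exact h.symm

/-- Every character of a finite group is a linear combination of irreducible characters. -/
theorem Representation.character_mem_span {G : Type} [Group G] [Fintype G] {N : ℕ}
    (χ : Fin N → FDRep ℂ G) (hcomplete : ∀ W : FDRep ℂ G, Simple W → ∃ t, Nonempty (W ≅ χ t))
    {W : Type} [AddCommGroup W] [Module ℂ W] [FiniteDimensional ℂ W] (ρ : Representation ℂ G W) :
    ρ.character ∈ Submodule.span ℂ (Set.range fun t ↦ (χ t).character) := by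
  induction hd : Module.finrank ℂ W using Nat.strong_induction_on generalizing W with
  | _ d ih =>
  by_cases hsub : Subsingleton W
  · have : ρ.character = 0 := by
      ext g
      rw [Representation.character, Subsingleton.elim (ρ g) 0, map_zero, Pi.zero_apply]
    rw [this]
    exact zero_mem _
  by_cases hirr : ρ.IsIrreducible
  · obtain ⟨t, ⟨e⟩⟩ := hcomplete _ (FDRep.simple_of_of_isIrreducible ρ)
    exact Submodule.subset_span ⟨t, (FDRep.char_iso e).symm⟩
  have hex : ∃ σ : Subrepresentation ρ, σ ≠ ⊥ ∧ σ ≠ ⊤ := by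
    by_contra! h
    have : Nontrivial (Subrepresentation ρ) := by
      rw [not_subsingleton_iff_nontrivial] at hsub
      refine ⟨⊥, ⊤, fun hbt ↦ ?_⟩
      exact bot_ne_top (α := Submodule ℂ W)
        (congrArg Subrepresentation.toSubmodule hbt)
    exact hirr ⟨fun σ ↦ or_iff_not_imp_left.2 (h σ)⟩
  obtain ⟨σ, hσ, hσ'⟩ := hex
  obtain ⟨τ, hτ⟩ := exists_isCompl σ
  have hcompl : IsCompl σ.toSubmodule τ.toSubmodule := by
    refine IsCompl.of_eq ?_ ?_
    · exact congrArg Subrepresentation.toSubmodule hτ.inf_eq_bot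
    · exact congrArg Subrepresentation.toSubmodule hτ.sup_eq_top
  have hrank := Submodule.finrank_add_eq_of_isCompl hcompl
  have hσ0 : Module.finrank ℂ σ.toSubmodule ≠ 0 := fun h ↦
    hσ (Subrepresentation.toSubmodule_injective (Submodule.finrank_eq_zero.1 h))
  have hτ0 : Module.finrank ℂ τ.toSubmodule ≠ 0 := fun h ↦
    hσ' (Subrepresentation.toSubmodule_injective
      (Submodule.eq_top_of_finrank_eq (by omega)))
  have hchar : ρ.character = σ.toRepresentation.character + τ.toRepresentation.character := by
    ext g
    have hint : DirectSum.IsInternal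
        (fun i : Bool ↦ bif i then σ.toSubmodule else τ.toSubmodule) := by
      rw [DirectSum.isInternal_submodule_iff_isCompl _ (i := true) (j := false) (by simp)
        (by ext b; cases b <;> simp)]
      exact hcompl
    have htr := LinearMap.trace_eq_sum_trace_restrict hint (f := ρ g) (by
      rintro (_ | _)
      · exact τ.apply_mem_toSubmodule g
      · exact σ.apply_mem_toSubmodule g)
    rw [Fintype.sum_bool] at htr
    exact htr
  rw [hchar]
  exact add_mem (ih _ (by omega) σ.toRepresentation rfl) (ih _ (by omega) τ.toRepresentation rfl)

/-- Powers of a character are again characters, realised on tensor powers. -/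
theorem FDRep.character_pow_mem_span {G : Type} [Group G] [Fintype G] {N : ℕ}
    (χ : Fin N → FDRep ℂ G) (hcomplete : ∀ W : FDRep ℂ G, Simple W → ∃ t, Nonempty (W ≅ χ t))
    (V : FDRep ℂ G) (n : ℕ) :
    V.character ^ n ∈ Submodule.span ℂ (Set.range fun t ↦ (χ t).character) := by
  obtain ⟨T, hT⟩ : ∃ T : FDRep ℂ G, T.character = V.character ^ n := by
    induction n with
    | zero =>
      refine ⟨FDRep.of (Representation.trivial ℂ G ℂ), ?_⟩
      ext g
      change LinearMap.trace ℂ ℂ 1 = 1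
      simp
    | succ n ih =>
      obtain ⟨T, hT⟩ := ih
      exact ⟨MonoidalCategoryStruct.tensorObj T V, by rw [FDRep.char_tensor, hT, pow_succ]⟩
  rw [← hT]
  exact Representation.character_mem_span χ hcomplete T.ρ

/-- If every irreducible constituent of `V^{⊗n}` has dimension `d`, then `V^{⊗n}` has
`(dim V)^n / d` constituents. -/
theorem bV_mul_eq_finrank_pow {G : Type} [Group G] [Fintype G]
    (hG : ∀ h g : G, ⁅h, g⁆ ∈ Subgroup.center G) {N : ℕ}
    (χ : Fin N → FDRep ℂ G)
    (hsimple : ∀ t, Simple (χ t))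
    (hdistinct : ∀ s t : Fin N, Nonempty (χ s ≅ χ t) → s = t)
    (hcomplete : ∀ W : FDRep ℂ G, Simple W → ∃ t, Nonempty (W ≅ χ t))
    (V : FDRep ℂ G) (n d : ℕ)
    (hd : ∀ t, ∑ g, V.character g ^ n * (χ t).character g⁻¹ ≠ 0 →
      Module.finrank ℂ (χ t) = d) :
    bV χ V n * d = (Module.finrank ℂ V : ℂ) ^ n := by
  have := invertibleOfNonzero (NeZero.ne (Nat.card G : ℂ))
  obtain ⟨m, hm⟩ := (Submodule.mem_span_range_iff_exists_fun ℂ).1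
    (FDRep.character_pow_mem_span χ hcomplete V n)
  have hm' : ∀ g, V.character g ^ n = ∑ t, m t * (χ t).character g := fun g ↦ by
    simpa using (congrFun hm g).symm
  have hcoef : ∀ t, (1 / (Fintype.card G : ℂ)) *
      ∑ g, V.character g ^ n * (χ t).character g⁻¹ = m t := fun t ↦ by
    have h1 : ∀ s, (1 / (Fintype.card G : ℂ)) *
        ∑ g, (χ s).character g * (χ t).character g⁻¹ = if s = t then 1 else 0 := fun s ↦ by
      have h := FDRep.char_orthonormal (χ s) (χ t)
      rw [Nat.card_eq_fintype_card, inv_eq_one_div] at h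
      rw [h]
      congr 1
      exact propext ⟨hdistinct s t, fun h ↦ h ▸ ⟨Iso.refl _⟩⟩
    simp_rw [hm', Finset.sum_mul]
    rw [Finset.sum_comm, Finset.mul_sum]
    calc _ = ∑ s, m s * if s = t then 1 else 0 := Finset.sum_congr rfl fun s _ ↦ by
          rw [← h1, mul_left_comm, Finset.mul_sum (a := m s)]
          simp_rw [mul_assoc]
      _ = m t := by simp
  have hbV : bV χ V n = ∑ t, m t := by
    refine Finset.sum_congr rfl fun t _ ↦ ?_
    simp_rw [FDRep.conj_character hG]
    exact hcoef t
  have h1 := hm' 1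
  simp only [FDRep.char_one] at h1
  rw [hbV, h1, Finset.sum_mul]
  refine Finset.sum_congr rfl fun t _ ↦ ?_
  by_cases ht : m t = 0
  · simp [ht]
  · rw [hd t]
    intro h0
    rw [← hcoef t, h0, mul_zero] at ht
    exact ht rfl

/-- A constituent `W` of the `n`-th tensor power of a faithful irreducible representation is
trivial on a central element `z` exactly when `z ^ n = 1`. -/
theorem FDRep.apply_eq_one_iff_of_sum_ne_zero {G : Type} [Group G] [Fintype G]
    (V W : FDRep ℂ G) [Simple V] [Simple W] (hV : Function.Injective V.ρ) (n : ℕ)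
    (h : ∑ g, V.character g ^ n * W.character g⁻¹ ≠ 0) {z : G} (hz : z ∈ Subgroup.center G) :
    W.ρ z = 1 ↔ z ^ n = 1 := by
  obtain ⟨c, hc⟩ := V.exists_eq_smul_one_of_mem_center hz
  obtain ⟨e, he⟩ := W.exists_eq_smul_one_of_mem_center (inv_mem hz)
  have hce : c ^ n * e = 1 := by
    have h1 : ∑ g, V.character g ^ n * W.character g⁻¹ =
        c ^ n * e * ∑ g, V.character g ^ n * W.character g⁻¹ := by
      conv_lhs => rw [← Equiv.sum_comp (Equiv.mulLeft z)]
      rw [Finset.mul_sum]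
      refine Finset.sum_congr rfl fun g _ ↦ ?_
      rw [Equiv.coe_mulLeft, V.character_mul_of_eq_smul_one hc, mul_inv_rev, W.char_mul_comm,
        W.character_mul_of_eq_smul_one he]
      ring
    exact (mul_eq_right₀ h).1 h1.symm
  have hW : W.ρ z = 1 ↔ e = 1 := by
    have hinv : W.ρ z * W.ρ z⁻¹ = 1 := by rw [← map_mul, mul_inv_cancel, map_one]
    constructor
    · intro h1
      rw [h1, one_mul, he] at hinv
      exact W.smul_one_injective (hinv.trans (one_smul _ _).symm)
    · rintro rfl
      rwa [he, one_smul, mul_one] at hinv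
  have hV' : z ^ n = 1 ↔ c ^ n = 1 := by
    rw [← hV.eq_iff, map_pow, map_one, hc, smul_pow, one_pow]
    constructor
    · intro h1
      exact V.smul_one_injective (h1.trans (one_smul _ _).symm)
    · intro h1
      rw [h1, one_smul]
  rw [hW, hV']
  constructor
  · rintro rfl
    simpa using hce
  · intro h1
    simpa [h1] using hce

/-- For a faithful irreducible representation `V` of the modular group, every constituent of
`V^{⊗n}` has dimension `p ^ (j - v)`, where `p ^ v = gcd (p ^ j) n`. -/
theorem modular_group_finrank_constituent {p j k : ℕ} (hp : p.Prime) (hjk : 2 * j ≤ k)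
    {G : Type} [Group G] [Fintype G] {a b : G} (ha : a ^ p ^ k = 1) (hb : b ^ p ^ j = 1)
    (hrel : b * a * b⁻¹ = a ^ (p ^ (k - j) + 1)) (hgen : Subgroup.closure {a, b} = ⊤)
    (hcard : Fintype.card G = p ^ (k + j)) (V W : FDRep ℂ G) [Simple V] [Simple W]
    (hV : Function.Injective V.ρ) {n v : ℕ} (hvj : v ≤ j) (hv : Nat.gcd (p ^ j) n = p ^ v)
    (h : ∑ g, V.character g ^ n * W.character g⁻¹ ≠ 0) :
    Module.finrank ℂ W = p ^ (j - v) := by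
  classical
  have hG := modular_group_commutator_mem_center hjk ha hrel hgen
  let S : Finset G := {g | ∀ h : G, ⁅h, g⁆ ^ n = 1}
  have hS : ∀ g, g ∈ S ↔ ∀ h : G, ⁅h, g⁆ ^ n = 1 := fun g ↦ by simp [S]
  have hn : ∀ x, p ^ j ∣ x * n ↔ p ^ (j - v) ∣ x := fun x ↦ by
    have hj : p ^ j = p ^ (j - v) * p ^ v := by rw [← pow_add, Nat.sub_add_cancel hvj]
    rw [← dvd_mul_gcd_iff_dvd_mul, gcd_eq_nat_gcd, hv, hj,
      Nat.mul_dvd_mul_iff_right (pow_pos hp.pos v)]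
  have hcardS := modular_group_card_commutator_pow_eq_one hp hjk ha hb hrel hgen hcard
    (Nat.sub_le j v) hn S hS
  have hdim := W.finrank_sq_mul_card hG S fun g ↦ by
    rw [hS]
    exact forall_congr' fun h' ↦
      (V.apply_eq_one_iff_of_sum_ne_zero W hV n h (hG h' g)).symm
  have hsplit : p ^ (k + j) =
      (p ^ (j - v)) ^ 2 * (p ^ (k - (j - v)) * p ^ (j - (j - v))) := by
    rw [← pow_mul, ← pow_add, ← pow_add]
    congr 1
    omega
  rw [hcardS, hcard, hsplit] at hdim
  have hpos : 0 < p ^ (k - (j - v)) * p ^ (j - (j - v)) :=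
    Nat.mul_pos (pow_pos hp.pos _) (pow_pos hp.pos _)
  exact Nat.pow_left_injective two_ne_zero (Nat.eq_of_mul_eq_mul_right hpos hdim)

theorem stmt_14 (p : ℕ) (hp : p.Prime) (j k : ℕ) (hj : 0 < j) (hjk : 2 * j ≤ k)
    -- `G` is the semidirect product `C_{p^k} ⋊ C_{p^j}` with presentation
    -- `⟨a, b | a^{p^k} = b^{p^j} = 1, b a b⁻¹ = a^{p^{k-j}+1}⟩`
    (G : Type) [Group G] [Fintype G] (a b : G)
    (ha : a ^ p ^ k = 1) (hb : b ^ p ^ j = 1)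
    (hrel : b * a * b⁻¹ = a ^ (p ^ (k - j) + 1))
    (hgen : Subgroup.closure {a, b} = ⊤)
    (hcard : Fintype.card G = p ^ (k + j))
    {N : ℕ}
    (χ : Fin N → FDRep ℂ G)
    (hsimple : ∀ t, Simple (χ t))
    (hdistinct : ∀ s t : Fin N, Nonempty (χ s ≅ χ t) → s = t)
    (hcomplete : ∀ W : FDRep ℂ G, Simple W → ∃ t, Nonempty (W ≅ χ t))
    (V : FDRep ℂ G) (hVfaith : Function.Injective V.ρ) (hVirr : Simple V)
    (n : ℕ) :
    bV χ V n = (((p : ℂ) ^ j) ^ n / (p : ℂ) ^ (k + j)) *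
      (((j : ℂ) + 1) * (p : ℂ) ^ k - (j : ℂ) * (p : ℂ) ^ (k - 1) +
        ((p : ℂ) ^ k - (p : ℂ) ^ (k - 1)) *
          ∑ m ∈ Finset.range j, ((m : ℂ) + 1) * ramanujanSum p (j - m) n) := by
  have hG := modular_group_commutator_mem_center hjk ha hrel hgen
  obtain ⟨v, hvj, hv⟩ := (Nat.dvd_prime_pow hp).1 (Nat.gcd_dvd_left (p ^ j) n)
  have hp0 : (p : ℂ) ≠ 0 := Nat.cast_ne_zero.2 hp.ne_zero
  have hV : Module.finrank ℂ V = p ^ j := by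
    refine modular_group_finrank_constituent hp hjk ha hb hrel hgen hcard V V hVfaith
      (n := 1) (v := 0) (Nat.zero_le j) (by simp) ?_
    simp only [pow_one]
    rw [(FDRep.simple_iff_char_is_norm_one V).1 hVirr]
    exact NeZero.ne _
  have hbV := bV_mul_eq_finrank_pow hG χ hsimple hdistinct hcomplete V n (p ^ (j - v))
    fun t ht ↦ modular_group_finrank_constituent hp hjk ha hb hrel hgen hcard V (χ t) hVfaith
      hvj hv ht
  have hram := sum_mul_ramanujanSum hp j n
  rw [hv] at hram
  rw [hV] at hbV
  push_cast at hbV hram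
  have hk : (p : ℂ) ^ k = p ^ (k - 1) * p := by rw [← pow_succ, Nat.sub_add_cancel (by omega)]
  have hsum : ((j : ℂ) + 1) * (p : ℂ) ^ k - (j : ℂ) * (p : ℂ) ^ (k - 1) +
        ((p : ℂ) ^ k - (p : ℂ) ^ (k - 1)) *
          ∑ m ∈ Finset.range j, ((m : ℂ) + 1) * ramanujanSum p (j - m) n =
      (p : ℂ) ^ k * p ^ v := by
    rw [hk]
    linear_combination (p : ℂ) ^ (k - 1) * hram
  have hj' : (p : ℂ) ^ j = p ^ (j - v) * p ^ v := by rw [← pow_add, Nat.sub_add_cancel hvj]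
  rw [hsum, ← hbV, pow_add, hj']
  field_simp
end

section
/- Let p be an odd prime, let 2 ≤ l ≤ p − 1, let ω = exp(2πi/p), and let M_l be the p×p matrix defined by (M_l)_{j,i} = #{ t : 1 ≤ t ≤ c, s − r + 2t − 1 = j } + (r − c)·[j = p], where r = min(l, i), s = max(l, i), and c = r if r + s ≤ p and c = p − s otherwise. Set k by l = 2k if l is even and l = p − 2k if l is odd. If l is even, the set of eigenvalues of M_l over ℂ is {l} ∪ { ε · Σ_{j=1}^{2k} ω^{m·(p−2k+2j−1)/2} : ε ∈ {+1, −1}, 1 ≤ m ≤ (p−1)/2 }. If l is odd, the set of eigenvalues of M_l over ℂ is {l} ∪ { − Σ_{j=1}^{2k} ω^{m·(p−2k+2j−1)/2} : 1 ≤ m ≤ (p−1)/2 }. -/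
open Finset

/-- The action matrix `M_l` of the `l`-dimensional indecomposable `kC_p`-module `V_l`
with respect to the basis `(V_1, …, V_p)` (indices shifted to be `1`-based): its
`(j, i)` entry is `#{t : 1 ≤ t ≤ c, s − r + 2t − 1 = j} + (r − c)·[j = p]`, where
`r = min(l, i)`, `s = max(l, i)`, and `c = r` if `r + s ≤ p`, `c = p − s` otherwise. -/
noncomputable def cyclicActionMatrix (p l : ℕ) : Matrix (Fin p) (Fin p) ℂ :=
  fun j i =>
    let r := min l (i.1 + 1)
    let s := max l (i.1 + 1)
    let c := if r + s ≤ p then r else p - s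
    ((((Finset.Icc 1 c).filter fun t => s - r + 2 * t - 1 = j.1 + 1).card : ℂ)) +
      ((r - c : ℕ) : ℂ) * (if j.1 + 1 = p then 1 else 0)

/-- The row vector `(f 1, …, f p)` times the `i`-th column of `cyclicActionMatrix p l`. -/
lemma sum_mul_cyclicActionMatrix {p l : ℕ} (hlp : l ≤ p) (f : ℕ → ℂ) (i : Fin p)
    {r s c : ℕ} (hr : r = min l (i.1 + 1)) (hs : s = max l (i.1 + 1))
    (hc : c = if r + s ≤ p then r else p - s) :
    ∑ j : Fin p, f (j.1 + 1) * cyclicActionMatrix p l j i =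
      ∑ t ∈ Icc 1 c, f (s - r + 2 * t - 1) + ((r - c : ℕ) : ℂ) * f p := by
  have hi := i.2
  have hsp : s ≤ p := by omega
  have hentry (j : Fin p) : cyclicActionMatrix p l j i =
      (∑ t ∈ Icc 1 c, if s - r + 2 * t - 1 = j.1 + 1 then (1 : ℂ) else 0) +
        ((r - c : ℕ) : ℂ) * (if j.1 + 1 = p then 1 else 0) := by
    subst hr hs hc
    simp only [cyclicActionMatrix, sum_boole]
  simp only [hentry, mul_add, sum_add_distrib, mul_sum]
  congr 1
  · rw [sum_comm]
    refine sum_congr rfl fun t ht => ?_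
    rw [mem_Icc] at ht
    have hlt : s - r + 2 * t - 2 < p := by split_ifs at hc <;> omega
    rw [sum_eq_single ⟨s - r + 2 * t - 2, hlt⟩]
    · have : s - r + 2 * t - 1 = s - r + 2 * t - 2 + 1 := by omega
      simp [this]
    · intro b _ hb
      have : ¬ (s - r + 2 * t - 1 = b.1 + 1) := fun h => hb (Fin.ext (by simp only; omega))
      simp [this]
    · simp
  · rw [sum_eq_single ⟨p - 1, by omega⟩]
    · have : p - 1 + 1 = p := by omega
      simp [this, mul_comm]
    · intro b _ hb
      have : ¬ (b.1 + 1 = p) := fun h => hb (Fin.ext (by simp only; omega))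
      simp [this]
    · simp

lemma sum_Icc_add_two_mul_sub_one (d c : ℕ) :
    ∑ t ∈ Icc 1 c, (d + 2 * t - 1) = c * (d + c) := by
  induction c with
  | zero => simp
  | succ c ih =>
    rw [sum_Icc_succ_top (by omega), ih, show d + 2 * (c + 1) - 1 = d + 2 * c + 1 by omega]
    ring

/-- Dimensions multiply under tensor products: `(1, …, p)` is a left eigenvector. -/
lemma dimension_vecMul_cyclicActionMatrix {p l : ℕ} (hlp : l ≤ p) (i : Fin p) :
    ∑ j : Fin p, ((j.1 + 1 : ℕ) : ℂ) * cyclicActionMatrix p l j i = l * ((i.1 + 1 : ℕ) : ℂ) := by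
  obtain ⟨r, hr⟩ : ∃ r, r = min l (i.1 + 1) := ⟨_, rfl⟩
  obtain ⟨s, hs⟩ : ∃ s, s = max l (i.1 + 1) := ⟨_, rfl⟩
  obtain ⟨c, hc⟩ : ∃ c, c = if r + s ≤ p then r else p - s := ⟨_, rfl⟩
  rw [sum_mul_cyclicActionMatrix hlp (fun n => (n : ℂ)) i hr hs hc]
  have hi := i.2
  have hprod : l * (i.1 + 1) = r * s := by rw [hr, hs, min_mul_max]
  rw [← Nat.cast_mul l, hprod, ← Nat.cast_sum, sum_Icc_add_two_mul_sub_one]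
  have hrs : r ≤ s := by omega
  have hsp : s ≤ p := by omega
  clear hprod hr hs
  norm_cast
  split_ifs at hc with h
  · subst hc
    obtain ⟨d, rfl⟩ := Nat.exists_eq_add_of_le hrs
    rw [Nat.add_sub_cancel_left, Nat.sub_self, zero_mul, add_zero, add_comm d c]
  · subst hc
    obtain ⟨d, rfl⟩ := Nat.exists_eq_add_of_le hsp
    obtain ⟨e, rfl⟩ := Nat.exists_eq_add_of_le (show d ≤ r by omega)
    obtain ⟨g, rfl⟩ := Nat.exists_eq_add_of_le hrs
    simp
    ring

lemma sub_inv_mul_sum_pow_sub_inv_pow {q : ℂ} (hq : q ≠ 0) (d c : ℕ) :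
    (q - q⁻¹) * ∑ t ∈ Icc 1 c, (q ^ (d + 2 * t - 1) - q⁻¹ ^ (d + 2 * t - 1)) =
      q ^ (d + 2 * c) + q⁻¹ ^ (d + 2 * c) - (q ^ d + q⁻¹ ^ d) := by
  induction c with
  | zero => simp
  | succ c ih =>
    rw [sum_Icc_succ_top (by omega), mul_add, ih,
      show d + 2 * (c + 1) - 1 = d + 2 * c + 1 by omega]
    have h : q * q⁻¹ = 1 := mul_inv_cancel₀ hq
    linear_combination (-q⁻¹ ^ (d + 2 * c) - q ^ (d + 2 * c)) * h

lemma inv_pow_eq_pow_of_add_eq {q : ℂ} {a b n : ℕ} (h : q ^ n = 1) (hab : a + b = n) :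
    q⁻¹ ^ a = q ^ b := by
  rw [inv_pow]
  exact (eq_inv_of_mul_eq_one_right (by rw [← pow_add, hab, h])).symm

/-- For a `2p`-th root of unity `q`, the numbers `q ^ n - q⁻¹ ^ n` form a left eigenvector. -/
lemma sine_vecMul_cyclicActionMatrix {p l : ℕ} (hlp : l ≤ p) {q : ℂ}
    (hq : q ^ (2 * p) = 1) (i : Fin p) :
    (q - q⁻¹) * ∑ j : Fin p, (q ^ (j.1 + 1) - q⁻¹ ^ (j.1 + 1)) * cyclicActionMatrix p l j i =
      (q ^ l - q⁻¹ ^ l) * (q ^ (i.1 + 1) - q⁻¹ ^ (i.1 + 1)) := by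
  obtain ⟨r, hr⟩ : ∃ r, r = min l (i.1 + 1) := ⟨_, rfl⟩
  obtain ⟨s, hs⟩ : ∃ s, s = max l (i.1 + 1) := ⟨_, rfl⟩
  obtain ⟨c, hc⟩ : ∃ c, c = if r + s ≤ p then r else p - s := ⟨_, rfl⟩
  have hi := i.2
  have hq0 : q ≠ 0 := by
    rintro rfl
    simp [show p ≠ 0 by omega] at hq
  have hprod : (q ^ l - q⁻¹ ^ l) * (q ^ (i.1 + 1) - q⁻¹ ^ (i.1 + 1)) =
      (q ^ r - q⁻¹ ^ r) * (q ^ s - q⁻¹ ^ s) := by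
    rcases le_total l (i.1 + 1) with h | h
    · rw [hr, hs, min_eq_left h, max_eq_right h]
    · rw [hr, hs, min_eq_right h, max_eq_left h, mul_comm]
  rw [sum_mul_cyclicActionMatrix hlp (fun n => q ^ n - q⁻¹ ^ n) i hr hs hc, hprod]
  have hrs : r ≤ s := by omega
  have hsp : s ≤ p := by omega
  clear hprod hr hs
  rw [inv_pow_eq_pow_of_add_eq hq (show p + p = 2 * p by ring), sub_self, mul_zero, add_zero,
    sub_inv_mul_sum_pow_sub_inv_pow hq0]
  have hrinv : q ^ r * q⁻¹ ^ r = 1 := by rw [← mul_pow, mul_inv_cancel₀ hq0, one_pow]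
  have hsum : q ^ (s - r + 2 * c) + q⁻¹ ^ (s - r + 2 * c) = q ^ (r + s) + q⁻¹ ^ (r + s) := by
    split_ifs at hc with h
    · rw [show s - r + 2 * c = r + s by omega]
    · rw [inv_pow_eq_pow_of_add_eq hq (show s - r + 2 * c + (r + s) = 2 * p by omega),
        inv_pow_eq_pow_of_add_eq hq (show r + s + (s - r + 2 * c) = 2 * p by omega), add_comm]
  rw [hsum]
  obtain ⟨d, rfl⟩ := Nat.exists_eq_add_of_le hrs
  rw [Nat.add_sub_cancel_left]
  simp only [pow_add]
  linear_combination (q ^ d + q⁻¹ ^ d) * hrinv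

/-- A column vector orthogonal to all the left eigenvectors above vanishes. -/
lemma eq_zero_of_orthogonal_left_eigenvectors {p : ℕ} (hp : 0 < p) {v : Fin p → ℂ}
    (hdim : ∑ j : Fin p, ((j.1 + 1 : ℕ) : ℂ) * v j = 0)
    (hsine : ∀ q : ℂ, q ^ (2 * p) = 1 →
      ∑ j : Fin p, (q ^ (j.1 + 1) - q⁻¹ ^ (j.1 + 1)) * v j = 0) : v = 0 := by
  classical
  -- `q ^ p` times the orthogonality relation is `P.eval q = 0`, up to the term `j = p - 1`
  let P : Polynomial ℂ := ∑ j : Fin p, if j.1 + 1 = p then 0 else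
    Polynomial.C (v j) * (Polynomial.X ^ (p + (j.1 + 1)) - Polynomial.X ^ (p - (j.1 + 1)))
  have hdeg : P.degree < ((2 * p : ℕ) : WithBot ℕ) := by
    rw [← Polynomial.mem_degreeLT]
    refine Submodule.sum_mem _ fun j _ => ?_
    have hj := j.2
    split_ifs with h
    · exact Submodule.zero_mem _
    · rw [← Polynomial.smul_eq_C_mul]
      refine Submodule.smul_mem _ _ (Submodule.sub_mem _ ?_ ?_) <;>
      · rw [Polynomial.mem_degreeLT, Polynomial.degree_X_pow]
        exact_mod_cast (by omega)
  have hP : P = 0 := by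
    have hcard : (Polynomial.nthRootsFinset (2 * p) (1 : ℂ)).card = 2 * p :=
      (Complex.isPrimitiveRoot_exp (2 * p) (by omega)).card_nthRootsFinset
    refine Polynomial.eq_zero_of_degree_lt_of_eval_finset_eq_zero
      (Polynomial.nthRootsFinset (2 * p) (1 : ℂ)) (by rwa [hcard]) fun q hq => ?_
    rw [Polynomial.mem_nthRootsFinset (by omega)] at hq
    have hq0 : q ≠ 0 := by
      rintro rfl
      simp [hp.ne'] at hq
    rw [Polynomial.eval_finsetSum, ← mul_zero (q ^ p), ← hsine q hq, mul_sum]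
    refine sum_congr rfl fun j _ => ?_
    have hj := j.2
    split_ifs with h
    · rw [h, inv_pow_eq_pow_of_add_eq hq (show p + p = 2 * p by ring)]
      simp
    · have hinv : q ^ (p - (j.1 + 1)) = q ^ p * q⁻¹ ^ (j.1 + 1) := by
        rw [inv_pow, pow_sub₀ _ hq0 (by omega)]
      simp only [Polynomial.eval_mul, Polynomial.eval_C, Polynomial.eval_sub,
        Polynomial.eval_pow, Polynomial.eval_X, hinv, pow_add]
      ring
  have hv (j : Fin p) (hj : j.1 + 1 ≠ p) : v j = 0 := by
    have hcoeff : P.coeff (p + (j.1 + 1)) = v j := by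
      rw [Polynomial.finsetSum_coeff, sum_eq_single j]
      · have : ¬ (p + (j.1 + 1) = p - (j.1 + 1)) := by omega
        simp [hj, Polynomial.coeff_X_pow, this]
      · intro b _ hb
        have h₁ : ¬ (p + (j.1 + 1) = p + (b.1 + 1)) := fun h => hb (Fin.ext (by omega))
        have h₂ : ¬ (p + (j.1 + 1) = p - (b.1 + 1)) := by omega
        split_ifs
        · simp
        · rw [Polynomial.coeff_C_mul, Polynomial.coeff_sub, Polynomial.coeff_X_pow,
            Polynomial.coeff_X_pow, if_neg h₁, if_neg h₂, sub_zero, mul_zero]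
      · simp
    rw [← hcoeff, hP, Polynomial.coeff_zero]
  funext j
  by_cases hj : j.1 + 1 = p
  · rw [sum_eq_single j] at hdim
    · exact (mul_eq_zero.1 hdim).resolve_left (Nat.cast_ne_zero.2 (Nat.succ_ne_zero _))
    · intro b _ hb
      rw [hv b fun h => hb (Fin.ext (by omega)), mul_zero]
    · simp
  · exact hv j hj

lemma exists_mulVec_eq_smul_of_vecMul_eq_smul {n : Type*} [Fintype n] [DecidableEq n]
    {K : Type*} [Field K] {A : Matrix n n K} {u : n → K} (hu : u ≠ 0) {a : K}
    (h : Matrix.vecMul u A = a • u) : ∃ v : n → K, v ≠ 0 ∧ A.mulVec v = a • v := by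
  have hdet : (A - a • (1 : Matrix n n K)).det = 0 :=
    Matrix.exists_vecMul_eq_zero_iff.1 ⟨u, hu, by
      rw [Matrix.vecMul_sub, h, Matrix.vecMul_smul, Matrix.vecMul_one, sub_self]⟩
  obtain ⟨v, hv, hAv⟩ := Matrix.exists_mulVec_eq_zero_iff.2 hdet
  refine ⟨v, hv, ?_⟩
  rwa [Matrix.sub_mulVec, Matrix.smul_mulVec, Matrix.one_mulVec, sub_eq_zero] at hAv

lemma eq_of_vecMul_eq_smul_of_mulVec_eq_smul {n : Type*} [Fintype n] {K : Type*} [Field K]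
    {A : Matrix n n K} {u v : n → K} {a b : K} (hu : Matrix.vecMul u A = a • u)
    (hv : A.mulVec v = b • v) (huv : u ⬝ᵥ v ≠ 0) : b = a := by
  have h := Matrix.dotProduct_mulVec u A v
  rw [hu, hv, dotProduct_smul, smul_dotProduct] at h
  exact mul_right_cancel₀ huv h

lemma sub_inv_ne_zero {q : ℂ} (hq0 : q ≠ 0) (hq : q ^ 2 ≠ 1) : q - q⁻¹ ≠ 0 := by
  intro h
  apply hq
  rw [sq]
  nth_rewrite 2 [sub_eq_zero.1 h]
  exact mul_inv_cancel₀ hq0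

/-- The eigenvalues of `cyclicActionMatrix p l` are `l` and the values at the `2p`-th roots of
unity other than `1` and `-1` of the character `(q ^ l - q⁻¹ ^ l) / (q - q⁻¹)`. -/
lemma eigenvalues_cyclicActionMatrix {p l : ℕ} (hp : 0 < p) (hlp : l ≤ p) :
    {μ : ℂ | ∃ v : Fin p → ℂ, v ≠ 0 ∧ (cyclicActionMatrix p l).mulVec v = μ • v} =
      insert (l : ℂ) {μ : ℂ | ∃ q : ℂ, q ^ (2 * p) = 1 ∧ q ^ 2 ≠ 1 ∧
        μ = (q ^ l - q⁻¹ ^ l) / (q - q⁻¹)} := by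
  have hdim : Matrix.vecMul (fun j : Fin p => ((j.1 + 1 : ℕ) : ℂ)) (cyclicActionMatrix p l) =
      (l : ℂ) • fun j : Fin p => ((j.1 + 1 : ℕ) : ℂ) :=
    funext fun i => dimension_vecMul_cyclicActionMatrix hlp i
  have hne (q : ℂ) (hq : q ^ (2 * p) = 1) (hq2 : q ^ 2 ≠ 1) : q - q⁻¹ ≠ 0 := by
    refine sub_inv_ne_zero ?_ hq2
    rintro rfl
    simp [hp.ne'] at hq
  have hsine (q : ℂ) (hq : q ^ (2 * p) = 1) (hq2 : q ^ 2 ≠ 1) :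
      Matrix.vecMul (fun j : Fin p => q ^ (j.1 + 1) - q⁻¹ ^ (j.1 + 1)) (cyclicActionMatrix p l) =
        ((q ^ l - q⁻¹ ^ l) / (q - q⁻¹)) •
          fun j : Fin p => q ^ (j.1 + 1) - q⁻¹ ^ (j.1 + 1) := by
    funext i
    apply mul_left_cancel₀ (hne q hq hq2)
    refine (sine_vecMul_cyclicActionMatrix hlp hq i).trans ?_
    rw [Pi.smul_apply, smul_eq_mul, ← mul_assoc, mul_div_cancel₀ _ (hne q hq hq2)]
  ext μ
  constructor
  · rintro ⟨v, hv, hμ⟩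
    by_contra hmem
    rw [Set.mem_insert_iff, not_or] at hmem
    apply hv
    refine eq_zero_of_orthogonal_left_eigenvectors hp ?_ fun q hq => ?_
    · by_contra h
      exact hmem.1 (eq_of_vecMul_eq_smul_of_mulVec_eq_smul hdim hμ h)
    · by_cases hq2 : q ^ 2 = 1
      · have : q⁻¹ = q := by
          rw [← pow_one q⁻¹, inv_pow_eq_pow_of_add_eq hq2 one_add_one_eq_two, pow_one]
        simp [this]
      · by_contra h
        exact hmem.2 ⟨q, hq, hq2, eq_of_vecMul_eq_smul_of_mulVec_eq_smul (hsine q hq hq2) hμ h⟩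
  · rintro (rfl | ⟨q, hq, hq2, rfl⟩)
    · refine exists_mulVec_eq_smul_of_vecMul_eq_smul (fun h => ?_) hdim
      exact Nat.cast_ne_zero.2 (Nat.succ_ne_zero 0) (congrFun h ⟨0, hp⟩)
    · refine exists_mulVec_eq_smul_of_vecMul_eq_smul (fun h => hne q hq hq2 ?_) (hsine q hq hq2)
      simpa using congrFun h ⟨0, hp⟩

/-- The balanced geometric sum, for a square root `z` of `w` with `z ^ p = 1`. -/
lemma sub_inv_mul_sum_pow {p k : ℕ} (hpk : 2 * k < p) (hodd : Odd p) {z w : ℂ} {m : ℕ}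
    (hz : z ^ p = 1) (hzw : z ^ 2 = w ^ m) :
    (z - z⁻¹) * ∑ i ∈ Icc 1 (2 * k), w ^ (m * ((p - 2 * k + 2 * i - 1) / 2)) =
      z ^ (2 * k) - z⁻¹ ^ (2 * k) := by
  have hz0 : z ≠ 0 := by
    rintro rfl
    simp [show p ≠ 0 by omega] at hz
  obtain ⟨n, rfl⟩ : ∃ n, p = 2 * k + 2 * n + 1 := by
    obtain ⟨a, ha⟩ := hodd
    exact ⟨a - k, by omega⟩
  have hterm (i : ℕ) (hi : i ∈ Icc 1 (2 * k)) :
      w ^ (m * ((2 * k + 2 * n + 1 - 2 * k + 2 * i - 1) / 2)) = z ^ (2 * n + 2 * i) := by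
    rw [pow_mul, ← hzw, ← pow_mul]
    congr 1
    omega
  have htel (c : ℕ) : (z - z⁻¹) * ∑ i ∈ Icc 1 c, z ^ (2 * n + 2 * i) =
      z ^ (2 * n + 2 * c + 1) - z ^ (2 * n + 1) := by
    induction c with
    | zero => simp
    | succ c ih =>
      rw [sum_Icc_succ_top (by omega), mul_add, ih]
      have h : z * z⁻¹ = 1 := mul_inv_cancel₀ hz0
      linear_combination (-z ^ (2 * n + 2 * c + 1)) * h
  rw [sum_congr rfl hterm, htel,
    inv_pow_eq_pow_of_add_eq hz (show 2 * k + (2 * n + 1) = 2 * k + 2 * n + 1 by ring),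
    show 2 * n + 2 * (2 * k) + 1 = 2 * k + (2 * k + 2 * n + 1) by ring, pow_add, hz, mul_one]

/-- Up to inversion, the `2p`-th roots of unity other than `1` and `-1` are `± z` with
`z ^ p = 1` and `z ^ 2 = w ^ m` for `1 ≤ m ≤ (p - 1) / 2`. -/
lemma exists_sq_eq_pow_of_pow_two_mul_eq_one {p : ℕ} (hodd : Odd p) {w : ℂ}
    (hw : IsPrimitiveRoot w p) {q : ℂ} (hq : q ^ (2 * p) = 1) (hq2 : q ^ 2 ≠ 1) :
    ∃ ε : ℂ, (ε = 1 ∨ ε = -1) ∧ ∃ m ∈ Icc 1 ((p - 1) / 2), ∃ z : ℂ,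
      z ^ p = 1 ∧ z ^ 2 = w ^ m ∧ (q = ε * z ∨ q⁻¹ = ε * z) := by
  have hpos : 0 < p := hodd.pos
  have : NeZero p := ⟨hpos.ne'⟩
  obtain ⟨ε, hε, hεq⟩ : ∃ ε : ℂ, (ε = 1 ∨ ε = -1) ∧ q ^ p = ε :=
    ⟨q ^ p, sq_eq_one_iff.1 (by rw [← pow_mul, mul_comm, hq]), rfl⟩
  have hε2 : ε * ε = 1 := by rcases hε with rfl | rfl <;> norm_num
  have hεinv : ε⁻¹ = ε := inv_eq_of_mul_eq_one_left hε2
  have hεp : ε ^ p = ε := by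
    rcases hε with rfl | rfl
    · exact one_pow p
    · exact hodd.neg_one_pow
  have hzp : (ε * q) ^ p = 1 := by rw [mul_pow, hεp, hεq, hε2]
  have hz2 : (ε * q) ^ 2 = q ^ 2 := by rw [mul_pow, sq ε, hε2, one_mul]
  have hqz : q = ε * (ε * q) := by rw [← mul_assoc, hε2, one_mul]
  obtain ⟨n, hn, hwn⟩ := hw.eq_pow_of_pow_eq_one (show (q ^ 2) ^ p = 1 by rw [← pow_mul, hq])
  have hn0 : n ≠ 0 := by
    rintro rfl
    exact hq2 (by rw [← hwn, pow_zero])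
  obtain ⟨a, ha⟩ := hodd
  refine ⟨ε, hε, ?_⟩
  by_cases hna : n ≤ a
  · exact ⟨n, mem_Icc.2 (by omega), ε * q, hzp, hz2.trans hwn.symm, Or.inl hqz⟩
  · refine ⟨p - n, mem_Icc.2 (by omega), (ε * q)⁻¹, by rw [inv_pow, hzp, inv_one], ?_, Or.inr ?_⟩
    · rw [inv_pow, hz2, ← hwn, ← inv_pow]
      exact inv_pow_eq_pow_of_add_eq hw.pow_eq_one (by omega)
    · rw [mul_inv, ← mul_assoc, hεinv, hε2, one_mul]

/-- The description of `eigenvalues_cyclicActionMatrix`, with the roots of unity parametrized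
up to inversion. -/
lemma exists_character_value_iff {p : ℕ} (hodd : Odd p) {w : ℂ} (hw : IsPrimitiveRoot w p)
    (l : ℕ) (μ : ℂ) :
    (∃ q : ℂ, q ^ (2 * p) = 1 ∧ q ^ 2 ≠ 1 ∧ μ = (q ^ l - q⁻¹ ^ l) / (q - q⁻¹)) ↔
      ∃ ε : ℂ, (ε = 1 ∨ ε = -1) ∧ ∃ m ∈ Icc 1 ((p - 1) / 2), ∃ z : ℂ, z ^ p = 1 ∧ z ^ 2 = w ^ m ∧
        μ = ((ε * z) ^ l - (ε * z)⁻¹ ^ l) / (ε * z - (ε * z)⁻¹) := by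
  constructor
  · rintro ⟨q, hq, hq2, rfl⟩
    obtain ⟨ε, hε, m, hm, z, hz, hzw, hqz | hqz⟩ :=
      exists_sq_eq_pow_of_pow_two_mul_eq_one hodd hw hq hq2
    · exact ⟨ε, hε, m, hm, z, hz, hzw, by rw [← hqz]⟩
    · refine ⟨ε, hε, m, hm, z, hz, hzw, ?_⟩
      rw [← hqz, inv_inv, ← neg_sub (q⁻¹ ^ l), ← neg_sub q⁻¹, neg_div_neg_eq]
  · rintro ⟨ε, hε, m, hm, z, hz, hzw, rfl⟩
    have hε2 : ε ^ 2 = 1 := sq_eq_one_iff.2 hε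
    refine ⟨ε * z, ?_, ?_, rfl⟩
    · rw [mul_pow, pow_mul, hε2, one_pow, mul_comm 2 p, pow_mul, hz, one_pow, one_mul]
    · rw [mul_pow, hε2, one_mul, hzw]
      rw [mem_Icc] at hm
      exact hw.pow_ne_one_of_pos_of_lt (by omega) (by omega)

lemma exists_pow_eq_one_and_sq_eq {p : ℕ} (hodd : Odd p) {x : ℂ} (hx : x ^ p = 1) :
    ∃ z : ℂ, z ^ p = 1 ∧ z ^ 2 = x := by
  obtain ⟨a, ha⟩ := hodd
  refine ⟨x ^ (a + 1), by rw [pow_right_comm, hx, one_pow], ?_⟩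
  rw [← pow_mul, show (a + 1) * 2 = p + 1 by omega, pow_succ, hx, one_mul]

/-- The values of the characters in terms of balanced geometric sums. -/
lemma character_value_eq {p k l : ℕ} (hpk : 2 * k < p) (hodd : Odd p) {w : ℂ}
    (hw : IsPrimitiveRoot w p) {m : ℕ} (hm : m ∈ Icc 1 ((p - 1) / 2)) {z ε : ℂ}
    (hz : z ^ p = 1) (hzw : z ^ 2 = w ^ m) (hε : ε = 1 ∨ ε = -1) :
    (l = 2 * k → ((ε * z) ^ l - (ε * z)⁻¹ ^ l) / (ε * z - (ε * z)⁻¹) =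
      ε * ∑ i ∈ Icc 1 (2 * k), w ^ (m * ((p - 2 * k + 2 * i - 1) / 2))) ∧
    (l + 2 * k = p → ((ε * z) ^ l - (ε * z)⁻¹ ^ l) / (ε * z - (ε * z)⁻¹) =
      -∑ i ∈ Icc 1 (2 * k), w ^ (m * ((p - 2 * k + 2 * i - 1) / 2))) := by
  have hS := sub_inv_mul_sum_pow hpk hodd hz hzw
  set S := ∑ i ∈ Icc 1 (2 * k), w ^ (m * ((p - 2 * k + 2 * i - 1) / 2))
  have hε2 : ε * ε = 1 := by rcases hε with rfl | rfl <;> norm_num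
  have hε0 : ε ≠ 0 := left_ne_zero_of_mul_eq_one hε2
  have hεinv : ε⁻¹ = ε := inv_eq_of_mul_eq_one_left hε2
  have hz0 : z ≠ 0 := by
    rintro rfl
    simp [show p ≠ 0 by omega] at hz
  have hzz : z - z⁻¹ ≠ 0 := by
    rw [mem_Icc] at hm
    refine sub_inv_ne_zero hz0 ?_
    rw [hzw]
    exact hw.pow_ne_one_of_pos_of_lt (by omega) (by omega)
  simp only [mul_inv, hεinv, ← mul_sub, div_eq_iff (mul_ne_zero hε0 hzz), mul_pow]
  constructor
  · rintro rfl
    rw [← hS, pow_mul ε, sq ε, hε2, one_pow]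
    linear_combination (-(z - z⁻¹) * S) * hε2
  · intro hl
    have hεl : ε ^ l = ε := by
      rcases hε with rfl | rfl
      · exact one_pow l
      · refine Odd.neg_one_pow ?_
        rw [← hl] at hodd
        exact (Nat.odd_add.1 hodd).2 (even_two_mul k)
    rw [hεl, inv_pow_eq_pow_of_add_eq hz hl,
      ← inv_pow_eq_pow_of_add_eq hz (show 2 * k + l = p by omega)]
    linear_combination ε * hS

theorem stmt_16 (p : ℕ) (hp : p.Prime) (hodd : Odd p)
    (l : ℕ) (hl : 2 ≤ l) (hl' : l ≤ p - 1)
    (k : ℕ) (hke : Even l → l = 2 * k) (hko : Odd l → l = p - 2 * k) :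
    (Even l →
      {μ : ℂ | ∃ v : Fin p → ℂ, v ≠ 0 ∧ (cyclicActionMatrix p l).mulVec v = μ • v} =
        insert ((l : ℂ))
          {μ : ℂ | ∃ ε : ℂ, (ε = 1 ∨ ε = -1) ∧ ∃ m ∈ Finset.Icc 1 ((p - 1) / 2),
            μ = ε * ∑ i ∈ Finset.Icc 1 (2 * k),
              Complex.exp (2 * Real.pi * Complex.I / (p : ℂ)) ^
                (m * ((p - 2 * k + 2 * i - 1) / 2))}) ∧
    (Odd l →
      {μ : ℂ | ∃ v : Fin p → ℂ, v ≠ 0 ∧ (cyclicActionMatrix p l).mulVec v = μ • v} =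
        insert ((l : ℂ))
          {μ : ℂ | ∃ m ∈ Finset.Icc 1 ((p - 1) / 2),
            μ = - ∑ i ∈ Finset.Icc 1 (2 * k),
              Complex.exp (2 * Real.pi * Complex.I / (p : ℂ)) ^
                (m * ((p - 2 * k + 2 * i - 1) / 2))}) := by
  have hw : IsPrimitiveRoot (Complex.exp (2 * Real.pi * Complex.I / (p : ℂ))) p :=
    Complex.isPrimitiveRoot_exp p hp.ne_zero
  have hroot (m : ℕ) : ∃ z : ℂ, z ^ p = 1 ∧
      z ^ 2 = Complex.exp (2 * Real.pi * Complex.I / (p : ℂ)) ^ m :=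
    exists_pow_eq_one_and_sq_eq hodd (by rw [pow_right_comm, hw.pow_eq_one, one_pow])
  have hp2 := hp.two_le
  rw [eigenvalues_cyclicActionMatrix hp.pos (by omega)]
  constructor
  · intro hle
    have hlk := hke hle
    congr 1
    ext μ
    simp only [Set.mem_ofPred_eq]
    rw [exists_character_value_iff hodd hw]
    constructor
    · rintro ⟨ε, hε, m, hm, z, hz, hzw, rfl⟩
      exact ⟨ε, hε, m, hm, (character_value_eq (by omega) hodd hw hm hz hzw hε).1 hlk⟩
    · rintro ⟨ε, hε, m, hm, rfl⟩
      obtain ⟨z, hz, hzw⟩ := hroot m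
      exact ⟨ε, hε, m, hm, z, hz, hzw,
        ((character_value_eq (by omega) hodd hw hm hz hzw hε).1 hlk).symm⟩
  · intro hlo
    have hlk : l + 2 * k = p := by
      have := hko hlo
      omega
    congr 1
    ext μ
    simp only [Set.mem_ofPred_eq]
    rw [exists_character_value_iff hodd hw]
    constructor
    · rintro ⟨ε, hε, m, hm, z, hz, hzw, rfl⟩
      exact ⟨m, hm, (character_value_eq (by omega) hodd hw hm hz hzw hε).2 hlk⟩
    · rintro ⟨m, hm, rfl⟩
      obtain ⟨z, hz, hzw⟩ := hroot m
      exact ⟨1, Or.inl rfl, m, hm, z, hz, hzw,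
        ((character_value_eq (by omega) hodd hw hm hz hzw (Or.inl rfl)).2 hlk).symm⟩
end

section
/- Let N ≥ 2 be an integer and let A be the 3×3 rational matrix with rows (0, 0, 0), (1, 2, 0), (0, N(N−1), 2N). Then for every n ≥ 1, the sum of the entries of the first column of A^n equals (1/4)·(2N)^n + ((2−N)/4)·2^n. -/
open Finset

/-- The first column of the `(n + 1)`-st power of the action matrix. -/
theorem actionMatrix_pow_succ_col_zero (x : ℚ) (n : ℕ) :
    ((!![(0 : ℚ), 0, 0; 1, 2, 0; 0, x * (x - 1), 2 * x] : Matrix (Fin 3) (Fin 3) ℚ) ^ (n + 1)).col 0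
      = ![0, 2 ^ n, ((2 * x) ^ (n + 1) - x * 2 ^ (n + 1)) / 4] := by
  induction n with
  | zero =>
    ext i
    fin_cases i <;> simp [Matrix.col_apply] <;> ring
  | succ n ih =>
    have h (i : Fin 3) := congrFun ih i
    simp only [Matrix.col_apply] at h
    ext i
    rw [pow_succ', Matrix.col_apply, Matrix.mul_apply, Fin.sum_univ_three, h, h, h]
    fin_cases i <;> simp <;> ring

theorem stmt_18 (N : ℕ) (hN : 2 ≤ N) (n : ℕ) (hn : 1 ≤ n) :
    ∑ i : Fin 3,
      ((!![(0 : ℚ), 0, 0;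
           1, 2, 0;
           0, (N : ℚ) * ((N : ℚ) - 1), 2 * (N : ℚ)] : Matrix (Fin 3) (Fin 3) ℚ) ^ n) i 0 =
    (1 / 4) * (2 * (N : ℚ)) ^ n + ((2 - (N : ℚ)) / 4) * 2 ^ n := by
  obtain ⟨n, rfl⟩ := Nat.exists_eq_add_of_le' hn
  have h (i : Fin 3) := congrFun (actionMatrix_pow_succ_col_zero (N : ℚ) n) i
  simp only [Matrix.col_apply] at h
  rw [Fin.sum_univ_three, h, h, h]
  simp
  ring
end
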